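/- Let K = u/v be shift-reduced with K ≠ 1, and let r ∈ F(y) be a residual form with respect to K. If r belongs to V_K, then r = 0. (Equivalently: a nonzero residual form with respect to K is not of the form K·σ(f) − f for any f ∈ F(y).) -/

import Mathlib

open Polynomial

noncomputable def pshift (F : Type*) [Field F] (i : ℤ) :
    Polynomial F →ₐ[F] Polynomial F :=
  aeval (X + C (i : F))

noncomputable def rshift (F : Type*) [Field F] (i : ℤ) : RatFunc F → RatFunc F :=
  fun f => RatFunc.mk (pshift F i f.num) (pshift F i f.denom)

def shiftFree {F : Type*} [Field F] (p : Polynomial F) : Prop :=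
  p ≠ 0 ∧ ∀ i : ℤ, i ≠ 0 → IsCoprime p (pshift F i p)

def shiftReducedPair {F : Type*} [Field F] (u v : Polynomial F) : Prop :=
  u ≠ 0 ∧ v ≠ 0 ∧ IsCoprime u v ∧ ∀ i : ℤ, IsCoprime u (pshift F i v)

def stronglyPrime {F : Type*} [Field F] (p u v : Polynomial F) : Prop :=
  p ≠ 0 ∧ ∀ i : ℕ, IsCoprime p (pshift F (-(i : ℤ)) u) ∧ IsCoprime p (pshift F (i : ℤ) v)

noncomputable def phiK {F : Type*} [Field F] (u v : Polynomial F) :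
    Polynomial F → Polynomial F :=
  fun p => u * pshift F 1 p - v * p

noncomputable def WK (F : Type*) [Field F] (u v : Polynomial F) :
    Submodule F (Polynomial F) :=
  Submodule.span F {q : Polynomial F | ∃ ℓ : ℕ, q = X ^ ℓ ∧
    ∀ w : Polynomial F, w ∈ Set.range (phiK u v) → w ≠ 0 → ℓ ≠ w.natDegree}

def VK {F : Type*} [Field F] (K : RatFunc F) : Set (RatFunc F) :=
  {g | ∃ r : RatFunc F, g = K * rshift F 1 r - r}

def residualForm {F : Type*} [Field F] (u v : Polynomial F) (r : RatFunc F) : Prop :=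
  ∃ a b q : Polynomial F, a.degree < b.degree ∧ shiftFree b ∧ stronglyPrime b u v ∧
    q ∈ WK F u v ∧ r = RatFunc.mk a b + RatFunc.mk q v

namespace PolynomialShift

variable {F : Type*} [Field F]

theorem pshift_pshift (i j : ℤ) (p : F[X]) :
    pshift F i (pshift F j p) = pshift F (i + j) p := by
  have h : (pshift F i).comp (pshift F j) = pshift F (i + j) := by
    ext
    simp [pshift, add_assoc]
  exact DFunLike.congr_fun h p

theorem pshift_zero (p : F[X]) : pshift F 0 p = p := by
  simp [pshift]

theorem pshift_dvd_pshift_of_dvd {p q : F[X]} (i : ℤ) {j k : ℤ} (h : pshift F j p ∣ q)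
    (hk : i + j = k) : pshift F k p ∣ pshift F i q := by
  rw [← hk, ← pshift_pshift i j p]
  obtain ⟨c, rfl⟩ := h
  exact ⟨pshift F i c, map_mul _ _ _⟩

/-- The shift by `i` as an automorphism of the polynomial ring. -/
noncomputable def pshiftEquiv (i : ℤ) : F[X] ≃ₐ[F] F[X] :=
  AlgEquiv.ofAlgHom (pshift F i) (pshift F (-i))
    (AlgHom.ext fun p => by simp [pshift_pshift, pshift_zero])
    (AlgHom.ext fun p => by simp [pshift_pshift, pshift_zero])

theorem irreducible_pshift {p : F[X]} (hp : Irreducible p) (i : ℤ) :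
    Irreducible (pshift F i p) :=
  (MulEquiv.irreducible_iff (pshiftEquiv (F := F) i)).2 hp

theorem pshift_ne_zero {p : F[X]} (hp : p ≠ 0) (i : ℤ) : pshift F i p ≠ 0 :=
  fun h =>
  hp ((pshiftEquiv (F := F) i).injective (h.trans (map_zero (pshiftEquiv (F := F) i)).symm))

theorem monic_pshift {p : F[X]} (hp : p.Monic) (i : ℤ) : (pshift F i p).Monic := by
  have h := hp.comp (monic_X_add_C (i : F)) (by rw [natDegree_X_add_C]; exact one_ne_zero)
  rwa [comp_eq_aeval] at h

theorem eval_pshift (i : ℤ) (p : F[X]) (x : F) :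
    (pshift F i p).eval x = p.eval (x + i) := by
  rw [pshift, ← comp_eq_aeval, eval_comp]
  simp

theorem natDegree_eq_zero_of_pshift_eq [CharZero F] {p : F[X]} {i : ℤ} (hi : i ≠ 0)
    (h : pshift F i p = p) : p.natDegree = 0 := by
  have hev (n : ℕ) : p.eval ((n : F) * i) = p.eval 0 := by
    induction n with
    | zero => simp
    | succ n ih =>
      rw [← ih]
      conv_rhs => rw [← h]
      rw [eval_pshift]
      congr 1
      push_cast
      ring
  have hinj : Function.Injective fun n : ℕ => (n : F) * (i : F) := fun m n hmn =>
    Nat.cast_injective (mul_right_cancel₀ (Int.cast_ne_zero.2 hi) hmn)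
  have hC : p = C (p.eval 0) := by
    refine eq_of_infinite_eval_eq _ _ ((Set.infinite_range_of_injective hinj).mono ?_)
    rintro _ ⟨n, rfl⟩
    simp [hev]
  rw [hC, natDegree_C]

theorem finite_setOf_pshift_dvd [CharZero F] {p t : F[X]} (hp : Irreducible p) (hm : p.Monic)
    (ht : t ≠ 0) : {i : ℤ | pshift F i p ∣ t}.Finite := by
  classical
  refine Set.Finite.of_injOn (f := fun i => pshift F i p)
    (t := ↑(UniqueFactorizationMonoid.normalizedFactors t).toFinset) ?_ ?_ (Finset.finite_toSet _)
  · intro i hi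
    obtain ⟨q, hq, hpq⟩ := UniqueFactorizationMonoid.exists_mem_normalizedFactors_of_dvd ht
      (irreducible_pshift hp i) hi
    have hn := UniqueFactorizationMonoid.normalize_normalized_factor q hq
    have : pshift F i p = q := by
      rw [← hn, ← (monic_pshift hm i).normalize_eq_self]
      exact normalize_eq_normalize hpq.dvd hpq.symm.dvd
    simpa only [this, Finset.mem_coe, Multiset.mem_toFinset] using hq
  · intro i _ j _ hij
    by_contra hne
    have h : pshift F (-j + i) p = p := by
      rw [← pshift_pshift]
      simp only at hij
      rw [hij, pshift_pshift, neg_add_cancel, pshift_zero]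
    exact hp.natDegree_pos.ne' (natDegree_eq_zero_of_pshift_eq (by omega) h)

theorem not_isCoprime_of_dvd {p x y : F[X]} (hp : Irreducible p) (hx : p ∣ x) (hy : p ∣ y) :
    ¬ IsCoprime x y := fun h => hp.not_isUnit (h.isUnit_of_dvd' hx hy)

/-- The denominator of a certificate for a residual form is constant. -/
theorem isUnit_of_residual_eq [CharZero F] {u v a b q s t : F[X]}
    (hsr : shiftReducedPair u v) (hb : shiftFree b) (hbs : stronglyPrime b u v)
    (hst : IsCoprime s t) (ht : t ≠ 0)
    (heq : (a * v + q * b) * pshift F 1 t * t =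
      b * (u * pshift F 1 s * t - v * s * pshift F 1 t)) : IsUnit t := by
  by_contra htu
  obtain ⟨p, hm, hp, hpt⟩ := exists_monic_irreducible_factor t htu
  have hfin := finite_setOf_pshift_dvd hp hm ht
  have hne : {i : ℤ | pshift F i p ∣ t}.Nonempty := ⟨0, by simpa [pshift_zero] using hpt⟩
  obtain ⟨M, hM, hMmax⟩ := hfin.exists_maximalFor id _ hne
  obtain ⟨m, hmt, hmin⟩ := hfin.exists_minimalFor id _ hne
  simp only [Set.mem_ofPred_eq, id] at hM hMmax hmt hmin
  have hmM : m ≤ M := by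
    by_contra hlt
    have := hMmax hmt (by omega)
    omega
  have hPirr := irreducible_pshift hp (M + 1)
  have hQirr := irreducible_pshift hp m
  have hPt : pshift F (M + 1) p ∣ pshift F 1 t := pshift_dvd_pshift_of_dvd 1 hM (by ring)
  have hPnt : ¬ pshift F (M + 1) p ∣ t := fun h => by
    have := hMmax h (by omega)
    omega
  have hQnt : ¬ pshift F m p ∣ pshift F 1 t := fun h => by
    have h' := pshift_dvd_pshift_of_dvd (-1) h (k := m - 1) (by ring)
    rw [pshift_pshift, neg_add_cancel, pshift_zero] at h'
    have := hmin h' (by omega)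
    omega
  have hPs : ¬ pshift F (M + 1) p ∣ pshift F 1 s := fun h =>
    not_isCoprime_of_dvd hPirr h hPt (hst.map (pshift F 1).toRingHom)
  have hQs : ¬ pshift F m p ∣ s := fun h => not_isCoprime_of_dvd hQirr h hmt hst
  have hP : pshift F (M + 1) p ∣ b ∨ pshift F (M + 1) p ∣ u := by
    have h : pshift F (M + 1) p ∣ b * u * pshift F 1 s * t := by
      have : b * u * pshift F 1 s * t =
          ((a * v + q * b) * t + b * v * s) * pshift F 1 t := by linear_combination -heq
      rw [this]
      exact hPt.mul_left _
    simpa [hPirr.prime.dvd_mul, hPnt, hPs] using h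
  have hQ : pshift F m p ∣ b ∨ pshift F m p ∣ v := by
    have h : pshift F m p ∣ b * v * s * pshift F 1 t := by
      have : b * v * s * pshift F 1 t =
          (b * u * pshift F 1 s - (a * v + q * b) * pshift F 1 t) * t := by
        linear_combination heq
      rw [this]
      exact hmt.mul_left _
    simpa [hQirr.prime.dvd_mul, hQnt, hQs] using h
  obtain ⟨n, hn⟩ : ∃ n : ℕ, (n : ℤ) = M + 1 - m := ⟨(M + 1 - m).toNat, by omega⟩
  rcases hP with hP | hP <;> rcases hQ with hQ | hQ
  · exact not_isCoprime_of_dvd hPirr hP (pshift_dvd_pshift_of_dvd n hQ (by omega))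
      (hb.2 n (by omega))
  · exact not_isCoprime_of_dvd hPirr hP (pshift_dvd_pshift_of_dvd n hQ (by omega)) (hbs.2 n).2
  · exact not_isCoprime_of_dvd hQirr hQ (pshift_dvd_pshift_of_dvd (-n) hP (by omega)) (hbs.2 n).1
  · exact not_isCoprime_of_dvd hPirr hP (pshift_dvd_pshift_of_dvd n hQ (by omega)) (hsr.2.2.2 n)

theorem coeff_eq_zero_of_mem_WK {u v q w : F[X]} (hq : q ∈ WK F u v) (hw : w ∈ Set.range (phiK u v))
    (hw0 : w ≠ 0) : q.coeff w.natDegree = 0 := by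
  have hle : WK F u v ≤ LinearMap.ker (lcoeff F w.natDegree) := by
    refine Submodule.span_le.2 ?_
    rintro _ ⟨l, rfl, hl⟩
    simp [coeff_X_pow, (hl w hw hw0).symm]
  exact hle hq

theorem eq_zero_of_mem_WK_of_mem_range {u v q : F[X]} (hq : q ∈ WK F u v)
    (hr : q ∈ Set.range (phiK u v)) : q = 0 := by
  by_contra h0
  exact leadingCoeff_ne_zero.2 h0 (coeff_eq_zero_of_mem_WK hq hr h0)

end PolynomialShift

open PolynomialShift in
/-- A residual form with respect to K lying in V_K is zero. -/
theorem stmt6 {F : Type*} [Field F] [CharZero F] (u v : Polynomial F) (r : RatFunc F)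
    (hsr : shiftReducedPair u v) (hK1 : RatFunc.mk u v ≠ 1)
    (hres : residualForm u v r) (h : r ∈ VK (RatFunc.mk u v)) :
    r = 0 := by
  obtain ⟨a, b, q, hab, hb, hbs, hq, rfl⟩ := hres
  obtain ⟨f, hf⟩ := h
  have hv := hsr.2.1
  have heq : (a * v + q * b) * pshift F 1 f.denom * f.denom =
      b * (u * pshift F 1 f.num * f.denom - v * f.num * pshift F 1 f.denom) := by
    have hfd : f = RatFunc.mk f.num f.denom := by
      rw [RatFunc.mk_eq_div, RatFunc.num_div_denom]
    have hinj := RatFunc.algebraMap_injective F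
    have h0 {p : F[X]} (hp : p ≠ 0) : algebraMap F[X] (RatFunc F) p ≠ 0 :=
      RatFunc.algebraMap_ne_zero hp
    have hb0 := h0 hb.1
    have hv0 := h0 hv
    have ht0 := h0 f.denom_ne_zero
    have hσ0 := h0 (pshift_ne_zero f.denom_ne_zero 1)
    rw [rshift] at hf
    nth_rewrite 3 [hfd] at hf
    simp only [RatFunc.mk_eq_div] at hf
    field_simp at hf
    apply hinj
    simp only [map_mul, map_add, map_sub]
    linear_combination hf
  have ht : f.denom = 1 := f.monic_denom.eq_one_of_isUnit
    (isUnit_of_residual_eq hsr hb hbs f.isCoprime_num_denom f.denom_ne_zero heq)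
  rw [ht, map_one] at heq
  have hbv : IsCoprime b v := by simpa [pshift_zero] using (hbs.2 0).2
  have hba : b ∣ a := hbv.dvd_of_dvd_mul_right
    ⟨u * pshift F 1 f.num - v * f.num - q, by linear_combination heq⟩
  have ha : a = 0 := eq_zero_of_dvd_of_degree_lt hba hab
  subst ha
  have hqf : phiK u v f.num = q := mul_left_cancel₀ hb.1 (by
    rw [phiK]
    linear_combination -heq)
  have hq0 := eq_zero_of_mem_WK_of_mem_range hq ⟨_, hqf⟩
  simp [hq0, RatFunc.mk_eq_div]
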